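/- Let F̄₅ be an algebraic closure of 𝔽₅ = ℤ/5ℤ, fix ζ ∈ F̄₅ of multiplicative order 8 with ζ² = 2, and let G̃ ⊆ GL₂(F̄₅) be the subgroup generated by the image of SL₂(𝔽₅), the scalar matrix 2·I, and the matrix [[0, ζ], [−ζ⁻¹, 0]]. Then G̃ has a subgroup of index 48 whose normal core in G̃ is trivial, and every subgroup of G̃ of index strictly less than 48 has nontrivial normal core; equivalently, 48 is the minimal number of letters on which G̃ acts faithfully and transitively as a permutation group. -/

import Mathlib

open Matrix

namespace Matrix.GeneralLinearGroup

/-- The scalar matrix `u • 1` commutes with every invertible matrix. -/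
lemma scalar_mul_comm {R : Type*} [CommRing R] (u : Rˣ) (g : GL (Fin 2) R) :
    g * GeneralLinearGroup.scalar (Fin 2) u = GeneralLinearGroup.scalar (Fin 2) u * g := by
  ext i k
  simp [mul_comm]

/-- An element of order dividing `15` in `GL₂(𝔽₅)` has order dividing `3` or `5`. -/
lemma pow_three_or_pow_five_eq_one (A : GL (Fin 2) (ZMod 5)) (h : A ^ 15 = 1) :
    A ^ 3 = 1 ∨ A ^ 5 = 1 := by
  have key : ∀ a b c d : ZMod 5, (!![a, b; c, d] : Matrix (Fin 2) (Fin 2) (ZMod 5)) ^ 15 = 1 →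
      (!![a, b; c, d] : Matrix (Fin 2) (Fin 2) (ZMod 5)) ^ 3 = 1 ∨
        (!![a, b; c, d] : Matrix (Fin 2) (Fin 2) (ZMod 5)) ^ 5 = 1 := by
    decide +kernel
  have h' := key (A.1 0 0) (A.1 0 1) (A.1 1 0) (A.1 1 1)
  rw [← Matrix.eta_fin_two] at h'
  simpa [Units.ext_iff] using h' (by simpa [Units.ext_iff] using h)

/-- Over a field where `2 ≠ 0`, the only involution of determinant `1` in `GL₂` is `-1`. -/
lemma eq_one_or_eq_neg_one_of_sq_eq_one {F : Type*} [Field F] (h2 : (2 : F) ≠ 0)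
    (g : GL (Fin 2) F) (hdet : GeneralLinearGroup.det g = 1) (hg : g ^ 2 = 1) :
    g = 1 ∨ g = -1 := by
  have hd : g.1 0 0 * g.1 1 1 - g.1 0 1 * g.1 1 0 = 1 := by
    have := congrArg Units.val hdet
    simpa [Matrix.det_fin_two] using this
  have hm : g.1 * g.1 = 1 := by simpa [Units.ext_iff, pow_two] using hg
  have e := fun i k => congrFun (congrFun hm i) k
  simp only [Matrix.mul_apply, Fin.sum_univ_two] at e
  have e00 := e 0 0
  have e01 := e 0 1
  have e10 := e 1 0
  have e11 := e 1 1
  simp at e00 e01 e10 e11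
  set a := g.1 0 0
  set b := g.1 0 1
  set c := g.1 1 0
  set d := g.1 1 1
  have ht : a + d ≠ 0 := fun ht => h2 (by linear_combination a * ht - e00 - hd)
  have hb : b = 0 := (mul_eq_zero.1 (by linear_combination e01 : b * (a + d) = 0)).resolve_right ht
  have hc : c = 0 := (mul_eq_zero.1 (by linear_combination e10 : c * (a + d) = 0)).resolve_right ht
  have hda : d = a := by
    have : (a + d) * (d - a) = 0 := by linear_combination e11 - e00
    exact sub_eq_zero.1 ((mul_eq_zero.1 this).resolve_left ht)
  have ha : a = 1 ∨ a = -1 := by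
    rw [hb] at e00
    exact mul_self_eq_one_iff.1 (by simpa using e00)
  have hg' : g.1 = !![a, b; c, d] := Matrix.eta_fin_two _
  rw [hda, hb, hc] at hg'
  rcases ha with ha | ha
  · left
    ext i k
    rw [hg', ha]
    fin_cases i <;> fin_cases k <;> simp
  · right
    ext i k
    rw [hg', ha]
    fin_cases i <;> fin_cases k <;> simp

end Matrix.GeneralLinearGroup

/-- A group of order `15` has an element of order `15`. -/
lemma exists_orderOf_eq_fifteen {K : Type*} [Group K] (hK : Nat.card K = 15) :
    ∃ g : K, orderOf g = 15 := by
  have : Finite K := Nat.finite_of_card_ne_zero (by omega)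
  have cube : ∀ a : ZMod 5, a * (a * a) = 1 → a = 1 := by decide
  have : Fact (Nat.Prime 3) := ⟨by norm_num⟩
  have : Fact (Nat.Prime 5) := ⟨by norm_num⟩
  obtain ⟨x, hx⟩ := exists_prime_orderOf_dvd_card' (G := K) 5 (by rw [hK]; norm_num)
  obtain ⟨y, hy⟩ := exists_prime_orderOf_dvd_card' (G := K) 3 (by rw [hK]; norm_num)
  have hN : (Subgroup.zpowers x).Normal := by
    apply Subgroup.normal_of_index_eq_minFac_card
    have := (Subgroup.zpowers x).card_mul_index
    rw [Nat.card_zpowers, hx, hK] at this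
    rw [hK, show Nat.minFac 15 = 3 by norm_num]
    omega
  have hc := hN.conj_mem x (Subgroup.mem_zpowers x) y
  rw [← mem_powers_iff_mem_zpowers] at hc
  obtain ⟨k, hk⟩ := hc
  simp only at hk
  have step : ∀ n, y * x ^ n * y⁻¹ = x ^ (k * n) := fun n => by
    rw [← conj_pow, ← hk, pow_mul]
  have h3 : x ^ (k * (k * k)) = x ^ 1 := by
    have hy3 : y ^ 3 = 1 := hy ▸ pow_orderOf_eq_one y
    rw [← step, ← step, hk]
    calc _ = y ^ 3 * x * (y ^ 3)⁻¹ := by simp only [pow_succ, pow_zero]; group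
      _ = _ := by simp [hy3]
  rw [pow_eq_pow_iff_modEq, hx] at h3
  have hk1 : k ≡ 1 [MOD 5] := by
    have hz : ((k : ZMod 5)) * (k * k) = 1 := by
      simpa using (ZMod.natCast_eq_natCast_iff _ _ _).2 h3
    exact (ZMod.natCast_eq_natCast_iff _ _ _).1 (by simpa using cube _ hz)
  have hxk : x ^ k = x ^ 1 := by rwa [pow_eq_pow_iff_modEq, hx]
  have hcomm : Commute x y := by
    have : y * x * y⁻¹ = x := by rw [← hk, hxk, pow_one]
    exact (mul_inv_eq_iff_eq_mul.1 this).symm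
  refine ⟨x * y, ?_⟩
  rw [hcomm.orderOf_mul_eq_mul_orderOf_of_coprime (by rw [hx, hy]; norm_num), hx, hy]

/-- The subgroup of matrices with bottom row `(0, 1)`. -/
def bottomRowSubgroup {F : Type*} [Field F] (G : Subgroup (GL (Fin 2) F)) : Subgroup G where
  carrier := {g | ![0, 1] ᵥ* (g : GL (Fin 2) F).1 = ![0, 1]}
  one_mem' := by simp
  mul_mem' {a b} ha hb := by
    simp only [Set.mem_ofPred_eq] at *
    rw [Subgroup.coe_mul, Units.val_mul, ← Matrix.vecMul_vecMul, ha, hb]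
  inv_mem' {a} ha := by
    simp only [Set.mem_ofPred_eq] at *
    nth_rw 1 [← ha]
    rw [Matrix.vecMul_vecMul, Subgroup.coe_inv, ← Units.val_mul, mul_inv_cancel, Units.val_one,
      Matrix.vecMul_one]

lemma mem_bottomRowSubgroup {F : Type*} [Field F] {G : Subgroup (GL (Fin 2) F)} {g : G} :
    g ∈ bottomRowSubgroup G ↔ g.1.1 1 0 = 0 ∧ g.1.1 1 1 = 1 := by
  change ![0, 1] ᵥ* g.1.1 = ![0, 1] ↔ _
  rw [funext_iff, Fin.forall_fin_two]
  simp [Matrix.vecMul, dotProduct, Fin.sum_univ_two]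

section TildeGroup

variable {F : Type} [Field F] [Algebra (ZMod 5) F]

lemma det_map_val (A : GL (Fin 2) (ZMod 5)) :
    ((GeneralLinearGroup.map (algebraMap (ZMod 5) F) A : GL (Fin 2) F) :
      Matrix (Fin 2) (Fin 2) F).det = algebraMap (ZMod 5) F A.1.det := by
  have := congrArg Units.val (GeneralLinearGroup.map_det (algebraMap (ZMod 5) F) A)
  simpa using this

variable (z : Fˣ)

/-- The elements `A` with `det A = ±1` and `ζ • A` with `det A = ±2`, for `A ∈ GL₂(𝔽₅)`. -/
def IsTilde (g : GL (Fin 2) F) : Prop :=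
  ∃ A : GL (Fin 2) (ZMod 5),
    (g = GeneralLinearGroup.map (algebraMap (ZMod 5) F) A ∧
      GeneralLinearGroup.det A ^ 2 = 1) ∨
    (g = GeneralLinearGroup.scalar (Fin 2) z * GeneralLinearGroup.map (algebraMap (ZMod 5) F) A ∧
      GeneralLinearGroup.det A ^ 2 = -1)

/-- The scalar matrix `2` over `𝔽₅`. -/
def two5 : (ZMod 5)ˣ := ⟨2, 3, by decide, by decide⟩

lemma five_eq_zero (F : Type) [Field F] [Algebra (ZMod 5) F] : (5 : F) = 0 := by
  have : algebraMap (ZMod 5) F 5 = algebraMap (ZMod 5) F 0 := congrArg _ (by decide)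
  rwa [map_zero, map_ofNat] at this

variable {z}

lemma scalar_sq (hz : (z : F) ^ 2 = 2) :
    GeneralLinearGroup.scalar (Fin 2) z * GeneralLinearGroup.scalar (Fin 2) z =
      GeneralLinearGroup.map (algebraMap (ZMod 5) F) (GeneralLinearGroup.scalar (Fin 2) two5) := by
  rw [GeneralLinearGroup.map_scalar, ← map_mul]
  congr 1
  ext
  simpa [two5, pow_two] using hz.trans (map_ofNat (algebraMap (ZMod 5) F) 2).symm

lemma det_scalar_sq (u : (ZMod 5)ˣ) :
    GeneralLinearGroup.det (GeneralLinearGroup.scalar (Fin 2) u) = u ^ 2 := by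
  ext
  simp [pow_two]

lemma two5_pow : (two5 ^ 2) ^ 2 = 1 ∧ two5 ^ 2 = -1 := by decide

lemma IsTilde.mul (hz : (z : F) ^ 2 = 2) {g h : GL (Fin 2) F} (hg : IsTilde z g)
    (hh : IsTilde z h) : IsTilde z (g * h) := by
  obtain ⟨A, ⟨rfl, hA⟩ | ⟨rfl, hA⟩⟩ := hg <;> obtain ⟨B, ⟨rfl, hB⟩ | ⟨rfl, hB⟩⟩ := hh
  · exact ⟨A * B, Or.inl ⟨by rw [map_mul], by rw [map_mul, mul_pow, hA, hB, one_mul]⟩⟩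
  · refine ⟨A * B, Or.inr ⟨?_, by rw [map_mul, mul_pow, hA, hB, one_mul]⟩⟩
    rw [← mul_assoc, GeneralLinearGroup.scalar_mul_comm, mul_assoc, map_mul]
  · exact ⟨A * B, Or.inr ⟨by rw [map_mul, mul_assoc], by rw [map_mul, mul_pow, hA, hB, mul_one]⟩⟩
  · refine ⟨GeneralLinearGroup.scalar (Fin 2) two5 * (A * B), Or.inl ⟨?_, ?_⟩⟩
    · rw [map_mul, ← scalar_sq hz, map_mul]
      exact Commute.mul_mul_mul_comm (GeneralLinearGroup.scalar_mul_comm _ _) _ _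
    · rw [map_mul, map_mul, mul_pow, mul_pow, hA, hB, det_scalar_sq, two5_pow.1]
      decide

lemma IsTilde.inv (hz : (z : F) ^ 2 = 2) {g : GL (Fin 2) F} (hg : IsTilde z g) :
    IsTilde z g⁻¹ := by
  obtain ⟨A, ⟨rfl, hA⟩ | ⟨rfl, hA⟩⟩ := hg
  · exact ⟨A⁻¹, Or.inl ⟨by rw [map_inv], by rw [map_inv, inv_pow, hA, inv_one]⟩⟩
  · refine ⟨(GeneralLinearGroup.scalar (Fin 2) two5)⁻¹ * A⁻¹, Or.inr ⟨?_, ?_⟩⟩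
    · rw [map_mul, map_inv, ← scalar_sq hz, map_inv, ← GeneralLinearGroup.scalar_mul_comm]
      group
    · rw [map_mul, map_inv, map_inv, mul_pow, inv_pow, inv_pow, hA, det_scalar_sq, two5_pow.1]
      decide

lemma IsTilde.det_eq (hz : (z : F) ^ 2 = 2) {g : GL (Fin 2) F} (hg : IsTilde z g) :
    GeneralLinearGroup.det g = 1 ∨ GeneralLinearGroup.det g = -1 := by
  have h5 := five_eq_zero F
  have hsq : g.1.det ^ 2 = 1 := by
    obtain ⟨A, ⟨rfl, hA⟩ | ⟨rfl, hA⟩⟩ := hg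
    · have hA' := congrArg (fun u : (ZMod 5)ˣ => algebraMap (ZMod 5) F u) hA
      rw [det_map_val]
      simpa using hA'
    · have hA' := congrArg (fun u : (ZMod 5)ˣ => algebraMap (ZMod 5) F u) hA
      rw [Units.val_mul, Matrix.det_mul, det_map_val]
      have hzd : (GeneralLinearGroup.scalar (Fin 2) z : Matrix (Fin 2) (Fin 2) F).det = 2 := by
        simp [← hz, pow_two]
      simp at hA'
      rw [hzd]
      linear_combination 4 * hA' - h5
  rcases mul_self_eq_one_iff.1 ((pow_two _).symm.trans hsq) with h | h
  · exact Or.inl (Units.ext (by simpa using h))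
  · exact Or.inr (Units.ext (by simpa using h))

lemma scalar_mul_map_ne_map (hz : (z : F) ^ 2 = 2) (A B : GL (Fin 2) (ZMod 5)) :
    GeneralLinearGroup.scalar (Fin 2) z * GeneralLinearGroup.map (algebraMap (ZMod 5) F) A ≠
      GeneralLinearGroup.map (algebraMap (ZMod 5) F) B := by
  intro h
  rw [← eq_mul_inv_iff_mul_eq, ← map_inv, ← map_mul] at h
  have h00 := congrArg (fun g : GL (Fin 2) F => g.1 0 0) h
  simp only [GeneralLinearGroup.map_apply] at h00
  have : Fact (Nat.Prime 5) := ⟨by norm_num⟩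
  have hc := congrArg (algebraMap (ZMod 5) F)
    (ZMod.pow_card ((B * A⁻¹ : GL (Fin 2) (ZMod 5)).1 0 0))
  rw [map_pow, ← h00] at hc
  simp at hc
  have h5 := five_eq_zero F
  have h4 : (3 : F) * z = 0 := by
    linear_combination hc - z * ((z : F) ^ 2 + 2) * hz
  have hz0 : (z : F) ≠ 0 := z.ne_zero
  have h3 := (mul_eq_zero.1 h4).resolve_right hz0
  exact one_ne_zero (by linear_combination 2 * h3 - h5 : (1 : F) = 0)

lemma mapGL_eq_map_toGL (A : SpecialLinearGroup (Fin 2) (ZMod 5)) :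
    SpecialLinearGroup.mapGL F A =
      GeneralLinearGroup.map (algebraMap (ZMod 5) F) (SpecialLinearGroup.toGL A) := by
  ext i k
  simp

lemma map_algebraMap_injective : Function.Injective
    (GeneralLinearGroup.map (n := Fin 2) (algebraMap (ZMod 5) F)) := by
  have : Fact (Nat.Prime 5) := ⟨by norm_num⟩
  intro A B h
  ext i k
  have := congrArg (fun g : GL (Fin 2) F => g.1 i k) h
  exact (algebraMap (ZMod 5) F).injective (by simpa using this)

/-- The matrix `[[0, 1], [2, 0]]` over `𝔽₅`. -/
def weyl5 : GL (Fin 2) (ZMod 5) :=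
  ⟨!![0, 1; 2, 0], !![0, 3; 1, 0], by decide, by decide⟩

lemma det_weyl5 : GeneralLinearGroup.det weyl5 ^ 2 = -1 := by
  ext
  simp only [Units.val_pow_eq_pow_val, GeneralLinearGroup.val_det_apply, weyl5, Matrix.det_fin_two]
  decide

lemma mem_iff_isTilde (hz : (z : F) ^ 2 = 2) (s j : GL (Fin 2) F)
    (hs : (s : Matrix (Fin 2) (Fin 2) F) = (2 : Matrix (Fin 2) (Fin 2) F))
    (hj : (j : Matrix (Fin 2) (Fin 2) F) = !![0, (z : F); -(z : F)⁻¹, 0]) (g : GL (Fin 2) F) :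
    g ∈ Subgroup.closure (Set.range (Matrix.SpecialLinearGroup.toGL.comp
        (Matrix.SpecialLinearGroup.map (algebraMap (ZMod 5) F))) ∪ {s, j}) ↔ IsTilde z g := by
  have h5 := five_eq_zero F
  have hz0 : (z : F) ≠ 0 := z.ne_zero
  have hs' : s = GeneralLinearGroup.map (algebraMap (ZMod 5) F)
      (GeneralLinearGroup.scalar (Fin 2) two5) := by
    have h2 : algebraMap (ZMod 5) F 2 = 2 := map_ofNat _ 2
    ext i k
    rw [hs]
    fin_cases i <;> fin_cases k <;> simp [two5, h2, Matrix.ofNat_apply]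
  have hj' : j = GeneralLinearGroup.scalar (Fin 2) z *
      GeneralLinearGroup.map (algebraMap (ZMod 5) F) weyl5 := by
    have h2 : algebraMap (ZMod 5) F 2 = 2 := map_ofNat _ 2
    ext i k
    rw [hj]
    fin_cases i <;> fin_cases k <;> simp [weyl5, h2]
    field_simp
    linear_combination -2 * hz - h5
  constructor
  · intro hg
    induction hg using Subgroup.closure_induction with
    | mem x hx =>
      rcases hx with ⟨A, rfl⟩ | rfl | rfl
      · exact ⟨SpecialLinearGroup.toGL A, Or.inl ⟨mapGL_eq_map_toGL A, by simp⟩⟩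
      · exact ⟨_, Or.inl ⟨hs', by rw [det_scalar_sq, two5_pow.1]⟩⟩
      · exact ⟨_, Or.inr ⟨hj', det_weyl5⟩⟩
    | one => exact ⟨1, Or.inl ⟨by simp, by simp⟩⟩
    | mul x y _ _ hx hy => exact hx.mul hz hy
    | inv x _ hx => exact hx.inv hz
  · have hsG := Subgroup.subset_closure (k := Set.range (Matrix.SpecialLinearGroup.toGL.comp
        (Matrix.SpecialLinearGroup.map (algebraMap (ZMod 5) F))) ∪ {s, j})
        (Or.inr (Or.inl rfl) : s ∈ _)
    have hjG := Subgroup.subset_closure (k := Set.range (Matrix.SpecialLinearGroup.toGL.comp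
        (Matrix.SpecialLinearGroup.map (algebraMap (ZMod 5) F))) ∪ {s, j})
        (Or.inr (Or.inr rfl) : j ∈ _)
    have hSL : ∀ A : GL (Fin 2) (ZMod 5), GeneralLinearGroup.det A = 1 →
        GeneralLinearGroup.map (algebraMap (ZMod 5) F) A ∈
          Subgroup.closure (Set.range (Matrix.SpecialLinearGroup.toGL.comp
            (Matrix.SpecialLinearGroup.map (algebraMap (ZMod 5) F))) ∪ {s, j}) := by
      intro A hA
      have hA' : A.1.det = 1 := by simpa using congrArg Units.val hA
      let A' : SpecialLinearGroup (Fin 2) (ZMod 5) := ⟨A.1, hA'⟩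
      have : SpecialLinearGroup.toGL A' = A := Units.ext rfl
      rw [← this, ← mapGL_eq_map_toGL]
      exact Subgroup.subset_closure (Or.inl ⟨_, rfl⟩)
    have hpm : ∀ A : GL (Fin 2) (ZMod 5), GeneralLinearGroup.det A ^ 2 = 1 →
        GeneralLinearGroup.map (algebraMap (ZMod 5) F) A ∈
          Subgroup.closure (Set.range (Matrix.SpecialLinearGroup.toGL.comp
            (Matrix.SpecialLinearGroup.map (algebraMap (ZMod 5) F))) ∪ {s, j}) := by
      intro A hA
      have hu : ∀ u : (ZMod 5)ˣ, u ^ 2 = 1 → u = 1 ∨ two5 ^ 2 * u = 1 := by decide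
      rcases hu _ hA with h | h
      · exact hSL A h
      · refine (Subgroup.mul_mem_cancel_left _ hsG).1 ?_
        nth_rw 2 [hs']
        rw [← map_mul]
        exact hSL _ (by rw [map_mul, det_scalar_sq, h])
    rintro ⟨A, ⟨rfl, hA⟩ | ⟨rfl, hA⟩⟩
    · exact hpm A hA
    · have : GeneralLinearGroup.scalar (Fin 2) z * GeneralLinearGroup.map (algebraMap (ZMod 5) F) A
          = j * GeneralLinearGroup.map (algebraMap (ZMod 5) F) (weyl5⁻¹ * A) := by
        rw [hj', map_mul, map_inv]
        group
      rw [this]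
      refine mul_mem hjG (hpm _ ?_)
      rw [map_mul, map_inv, mul_pow, inv_pow, det_weyl5, hA, inv_mul_cancel]

lemma natCard_tilde (hz : (z : F) ^ 2 = 2) (G : Subgroup (GL (Fin 2) F))
    (hG : ∀ g, g ∈ G ↔ IsTilde z g) : Nat.card G = 480 := by
  classical
  have hu : ∀ u : (ZMod 5)ˣ, u ^ 2 = 1 ∨ u ^ 2 = -1 := by decide
  have : Fact (Nat.Prime 5) := ⟨by norm_num⟩
  let f : GL (Fin 2) (ZMod 5) → GL (Fin 2) F := fun A =>
    if GeneralLinearGroup.det A ^ 2 = 1 then GeneralLinearGroup.map (algebraMap (ZMod 5) F) A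
    else GeneralLinearGroup.scalar (Fin 2) z * GeneralLinearGroup.map (algebraMap (ZMod 5) F) A
  have hf : Function.Injective f := by
    intro A B h
    simp only [f] at h
    split_ifs at h
    · exact map_algebraMap_injective h
    · exact (scalar_mul_map_ne_map hz _ _ h.symm).elim
    · exact (scalar_mul_map_ne_map hz _ _ h).elim
    · exact map_algebraMap_injective (mul_left_cancel h)
  have hr : Set.range f = G := by
    ext g
    rw [SetLike.mem_coe, hG]
    constructor
    · rintro ⟨A, rfl⟩
      refine ⟨A, ?_⟩
      by_cases h : GeneralLinearGroup.det A ^ 2 = 1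
      · exact Or.inl ⟨if_pos h, h⟩
      · exact Or.inr ⟨if_neg h, (hu _).resolve_left h⟩
    · rintro ⟨A, ⟨rfl, hA⟩ | ⟨rfl, hA⟩⟩
      · exact ⟨A, if_pos hA⟩
      · exact ⟨A, if_neg (by rw [hA]; decide)⟩
  have hc := Matrix.card_GL_field (𝔽 := ZMod 5) 2
  rw [← SetLike.coe_sort_coe, ← hr, Nat.card_range_of_injective hf, hc]
  simp [Fin.prod_univ_two]

/-- Every subgroup not containing `-1` has index at least `48`. -/
lemma le_index_of_neg_one_notMem (hz : (z : F) ^ 2 = 2) (G : Subgroup (GL (Fin 2) F))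
    (hG : ∀ g, g ∈ G ↔ IsTilde z g) (H : Subgroup G) (hH : ∀ h ∈ H, (h : GL (Fin 2) F) ≠ -1) :
    48 ≤ H.index := by
  have h5 := five_eq_zero F
  have h2 : (2 : F) ≠ 0 := fun h => one_ne_zero (by linear_combination h5 - 2 * h : (1 : F) = 0)
  have hcard := natCard_tilde hz G hG
  have : Finite G := Nat.finite_of_card_ne_zero (by omega)
  let d : H →* Fˣ := (GeneralLinearGroup.det.comp G.subtype).comp H.subtype
  have hrange : Nat.card d.range ≤ 2 := by
    have hsub : (d.range : Set Fˣ) ⊆ {1, -1} := by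
      rintro _ ⟨h, rfl⟩
      exact ((hG _).1 h.1.2).det_eq hz
    calc Nat.card d.range = (d.range : Set Fˣ).ncard := rfl
      _ ≤ ({1, -1} : Set Fˣ).ncard := Set.ncard_le_ncard hsub
      _ ≤ 2 := (Set.ncard_insert_le _ _).trans (by simp)
  have hodd : ¬ 2 ∣ Nat.card d.ker := by
    intro h
    have : Fact (Nat.Prime 2) := ⟨by norm_num⟩
    obtain ⟨x, hx⟩ := exists_prime_orderOf_dvd_card' 2 h
    have hx2 : (x.1.1.1 : GL (Fin 2) F) ^ 2 = 1 := by
      have : x ^ 2 = 1 := by rw [← orderOf_dvd_iff_pow_eq_one, hx]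
      simpa using congrArg (fun y : d.ker => (y.1.1.1 : GL (Fin 2) F)) this
    rcases GeneralLinearGroup.eq_one_or_eq_neg_one_of_sq_eq_one h2 _ x.2 hx2 with h1 | h1
    · have : x = 1 := by
        apply Subtype.ext; apply Subtype.ext; apply Subtype.ext
        exact h1
      rw [this, orderOf_one] at hx
      omega
    · exact hH _ x.1.2 h1
  have h15 : Nat.card d.ker ≠ 15 := by
    intro h
    obtain ⟨x, hx⟩ := exists_orderOf_eq_fifteen h
    have hx15 : x ^ 15 = 1 := by rw [← orderOf_dvd_iff_pow_eq_one, hx]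
    let φ : d.ker →* GL (Fin 2) F := (G.subtype.comp H.subtype).comp d.ker.subtype
    have hφ : Function.Injective φ := fun a b hab =>
      Subtype.ext (Subtype.ext (Subtype.ext hab))
    obtain ⟨C, hC⟩ : ∃ C, φ x = GeneralLinearGroup.map (algebraMap (ZMod 5) F) C := by
      obtain ⟨A, ⟨hA, -⟩ | ⟨hA, -⟩⟩ := (hG _).1 x.1.1.2
      · exact ⟨A, hA⟩
      · refine ⟨(GeneralLinearGroup.scalar (Fin 2) two5 * (A * A)) ^ 8, ?_⟩
        rw [map_pow, map_mul, ← scalar_sq hz, map_mul,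
          ← Commute.mul_mul_mul_comm (GeneralLinearGroup.scalar_mul_comm _ _), ← hA]
        change φ x = (φ x * φ x) ^ 8
        rw [← map_mul, ← map_pow, ← pow_two, ← pow_mul, pow_succ x 15, hx15, one_mul]
    have hpow : ∀ n, C ^ n = 1 → 15 ∣ n := fun n hn => by
      rw [← hx, orderOf_dvd_iff_pow_eq_one]
      apply hφ
      rw [map_pow, hC, ← map_pow, hn, map_one, map_one]
    have hC15 : C ^ 15 = 1 := by
      apply map_algebraMap_injective (F := F)
      rw [map_pow, ← hC, ← map_pow, hx15, map_one, map_one]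
    rcases GeneralLinearGroup.pow_three_or_pow_five_eq_one C hC15 with h3 | h3
    · exact absurd (hpow 3 h3) (by norm_num)
    · exact absurd (hpow 5 h3) (by norm_num)
  have hH480 : Nat.card H * H.index = 480 := by rw [H.card_mul_index, hcard]
  have hker : Nat.card d.ker * Nat.card d.range = Nat.card H := by
    rw [← Subgroup.index_ker, Subgroup.card_mul_index]
  have hdvd : Nat.card d.ker ∣ 15 := by
    have h1 : Nat.card d.ker ∣ 32 * 15 := ⟨Nat.card d.range * H.index, by
      rw [← mul_assoc, hker, hH480]⟩
    have h2 : Nat.Coprime (Nat.card d.ker) (2 ^ 5) :=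
      Nat.Coprime.pow_right _ (Nat.coprime_comm.1
        ((Nat.Prime.coprime_iff_not_dvd (by norm_num)).2 hodd))
    exact h2.dvd_of_dvd_mul_left h1
  have hle : Nat.card d.ker ≤ 5 := by
    have : Nat.card d.ker ∈ Nat.divisors 15 := by simpa using hdvd
    rw [show Nat.divisors 15 = {1, 3, 5, 15} by decide +kernel] at this
    simp only [Finset.mem_insert, Finset.mem_singleton] at this
    omega
  have hle10 : Nat.card H ≤ 10 := by
    rw [← hker]
    exact Nat.mul_le_mul hle hrange
  by_contra! hlt
  have : Nat.card H * H.index ≤ 10 * 47 := Nat.mul_le_mul hle10 (by omega)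
  omega

/-- The affine matrix `[[e, b], [0, 1]]` over `𝔽₅`. -/
def affine5 (p : ℤˣ × ZMod 5) : GL (Fin 2) (ZMod 5) :=
  ⟨!![((p.1 : ℤ) : ZMod 5), p.2; 0, 1],
    !![((p.1 : ℤ) : ZMod 5), -((p.1 : ℤ) : ZMod 5) * p.2; 0, 1],
    by revert p; decide, by revert p; decide⟩

lemma affine5_injective : Function.Injective affine5 := by
  intro p q h
  have h0 : (affine5 p).1 0 0 = (affine5 q).1 0 0 := by rw [h]
  have h1 : (affine5 p).1 0 1 = (affine5 q).1 0 1 := by rw [h]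
  have key : ∀ a b : ℤˣ, ((a : ℤ) : ZMod 5) = ((b : ℤ) : ZMod 5) → a = b := by decide
  exact Prod.ext (key _ _ h0) h1

lemma det_affine5 (p : ℤˣ × ZMod 5) : GeneralLinearGroup.det (affine5 p) ^ 2 = 1 := by
  have key : ∀ a : ℤˣ, ((a : ℤ) : ZMod 5) ^ 2 = 1 := by decide
  ext
  simpa [affine5, Matrix.det_fin_two] using key p.1

lemma ten_le_natCard_bottomRowSubgroup (G : Subgroup (GL (Fin 2) F)) [Finite G]
    (hG : ∀ g, g ∈ G ↔ IsTilde z g) : 10 ≤ Nat.card (bottomRowSubgroup G) := by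
  let f : ℤˣ × ZMod 5 → bottomRowSubgroup G := fun p =>
    ⟨⟨GeneralLinearGroup.map (algebraMap (ZMod 5) F) (affine5 p),
      (hG _).2 ⟨_, Or.inl ⟨rfl, det_affine5 p⟩⟩⟩,
      mem_bottomRowSubgroup.2 ⟨by simp [affine5], by simp [affine5]⟩⟩
  have hf : Function.Injective f := fun p q h =>
    affine5_injective (map_algebraMap_injective (F := F)
      (congrArg (fun y : bottomRowSubgroup G => y.1.1) h))
  have := Nat.card_le_card_of_injective f hf
  simpa using this

lemma normalCore_bottomRowSubgroup (G : Subgroup (GL (Fin 2) F))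
    (hG : ∀ g, g ∈ G ↔ IsTilde z g) : (bottomRowSubgroup G).normalCore = ⊥ := by
  let r : GL (Fin 2) (ZMod 5) := ⟨!![0, 1; -1, 0], !![0, -1; 1, 0], by decide, by decide⟩
  have hr : GeneralLinearGroup.det r ^ 2 = 1 := by
    ext
    simp [r, Matrix.det_fin_two]
  let w : G := ⟨GeneralLinearGroup.map (algebraMap (ZMod 5) F) r, (hG _).2 ⟨r, Or.inl ⟨rfl, hr⟩⟩⟩
  rw [eq_bot_iff]
  intro g hg
  obtain ⟨h10, h11⟩ := mem_bottomRowSubgroup.1 (Subgroup.normalCore_le _ hg)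
  obtain ⟨k10, k11⟩ := mem_bottomRowSubgroup.1 (hg w)
  have hw : w.1.1 = !![0, 1; -1, 0] := by
    ext i k
    fin_cases i <;> fin_cases k <;> simp [w, r]
  have hw' : (w⁻¹ : G).1.1 = !![0, -1; 1, 0] := by
    change (GeneralLinearGroup.map (algebraMap (ZMod 5) F) r⁻¹).1 = _
    ext i k
    fin_cases i <;> fin_cases k <;> simp [r]
  simp only [Subgroup.coe_mul, Units.val_mul, hw, hw'] at k10 k11
  simp [Matrix.mul_apply, Matrix.vecMul, dotProduct, Fin.sum_univ_two] at k10 k11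
  rw [Subgroup.mem_bot]
  ext i k
  fin_cases i <;> fin_cases k <;> simp [*]

end TildeGroup

/-- The group `G̃ = 4₋PGL₂(𝔽₅) = C₄·₆S₅ ⊆ GL₂(F̄₅)` (generated by the image of
`SL₂(𝔽₅)`, the scalar matrix `2·I` and `[[0, ζ], [-ζ⁻¹, 0]]`) has a subgroup of index
`48` with trivial normal core, and every subgroup of index `< 48` has nontrivial normal
core: `48` is the minimal number of letters on which `G̃` acts faithfully and
transitively. -/
theorem minimal_faithful_transitive_degree_48
    (F : Type) [Field F] [Algebra (ZMod 5) F] [IsAlgClosed F] [Algebra.IsAlgebraic (ZMod 5) F]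
    (ζ : F) (hζ8 : orderOf ζ = 8) (hζ2 : ζ ^ 2 = 2)
    (s j : Matrix.GeneralLinearGroup (Fin 2) F)
    (hs : (s : Matrix (Fin 2) (Fin 2) F) = (2 : Matrix (Fin 2) (Fin 2) F))
    (hj : (j : Matrix (Fin 2) (Fin 2) F) = !![0, ζ; -ζ⁻¹, 0])
    (G : Subgroup (Matrix.GeneralLinearGroup (Fin 2) F))
    (hG : G = Subgroup.closure
      (Set.range (Matrix.SpecialLinearGroup.toGL.comp
        (Matrix.SpecialLinearGroup.map (algebraMap (ZMod 5) F))) ∪ {s, j})) :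
    (∃ H : Subgroup G, H.index = 48 ∧ H.normalCore = ⊥) ∧
      ∀ H : Subgroup G, H.index < 48 → H.normalCore ≠ ⊥ := by
  have h5 := five_eq_zero F
  have h2 : (2 : F) ≠ 0 := fun h => one_ne_zero (by linear_combination h5 - 2 * h : (1 : F) = 0)
  have hζ0 : ζ ≠ 0 := by
    rintro rfl
    exact h2 (by simpa using hζ2.symm)
  lift ζ to Fˣ using hζ0.isUnit
  have hmem : ∀ g, g ∈ G ↔ IsTilde ζ g := fun g => hG ▸ mem_iff_isTilde hζ2 s j hs hj g
  have hcard := natCard_tilde hζ2 G hmem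
  have : Finite G := Nat.finite_of_card_ne_zero (by omega)
  have hlow : ∀ H : Subgroup G, H.normalCore = ⊥ → 48 ≤ H.index := by
    intro H hH
    refine le_index_of_neg_one_notMem hζ2 G hmem H fun h hh hneg => ?_
    have hcore : h ∈ H.normalCore := fun g => by
      have : g * h * g⁻¹ = h := by
        ext1
        simp [hneg]
      rwa [this]
    rw [hH, Subgroup.mem_bot] at hcore
    rw [hcore] at hneg
    have h00 := congrArg (fun g : GL (Fin 2) F => g.1 0 0) hneg
    simp at h00
    exact h2 (by linear_combination h00)
  refine ⟨⟨bottomRowSubgroup G, ?_, normalCore_bottomRowSubgroup G hmem⟩,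
    fun H hlt hH => absurd (hlow H hH) (by omega)⟩
  have hge := hlow _ (normalCore_bottomRowSubgroup G hmem)
  have hten := ten_le_natCard_bottomRowSubgroup G hmem
  have hprod : Nat.card (bottomRowSubgroup G) * (bottomRowSubgroup G).index = 480 := by
    rw [Subgroup.card_mul_index, hcard]
  nlinarith
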